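/- For every finite sequence l of positive real numbers, ḡ(l† ⧺ l) ≤ ḡ(l), where l† denotes the reversed sequence of inverses and ⧺ denotes concatenation. -/

import Mathlib

/-- `g(x) = max{x, 1/x}`. -/
noncomputable def gfun (x : ℝ) : ℝ := max x x⁻¹

/-- The squeezing parameter `ḡ` of a finite sequence of squeezing strengths:
the maximum of `g` over the products of all contiguous subsequences
(with the convention `ḡ = 1` for the empty sequence, realized by the empty
contiguous subsequence). -/
noncomputable def gbar (l : List ℝ) : ℝ :=
  sSup {x : ℝ | ∃ l₁ l₂ l₃ : List ℝ, l = l₁ ++ l₂ ++ l₃ ∧ x = gfun l₂.prod}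

/-- The adjoint sequence `l† = (η_T⁻¹, …, η_1⁻¹)`. -/
noncomputable def dagger (l : List ℝ) : List ℝ := (l.map fun x => x⁻¹).reverse

theorem gfun_inv (x : ℝ) : gfun x⁻¹ = gfun x := by
  simp [gfun, max_comm]

theorem dagger_dagger (l : List ℝ) : dagger (dagger l) = l := by
  simp [dagger]

theorem dagger_append (l m : List ℝ) : dagger (l ++ m) = dagger m ++ dagger l := by
  simp [dagger]

theorem prod_dagger (l : List ℝ) : (dagger l).prod = l.prod⁻¹ := by
  rw [dagger, List.prod_reverse, List.prod_inv]

theorem gfun_prod_le_gbar {l m : List ℝ} (h : m <:+: l) : gfun m.prod ≤ gbar l := by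
  have hfin : {x : ℝ | ∃ l₁ l₂ l₃ : List ℝ, l = l₁ ++ l₂ ++ l₃ ∧ x = gfun l₂.prod}.Finite := by
    refine (l.sublists.finite_toSet.image fun m => gfun m.prod).subset ?_
    rintro x ⟨l₁, l₂, l₃, h, rfl⟩
    exact ⟨l₂, List.mem_sublists.2 (List.IsInfix.sublist ⟨l₁, l₃, h.symm⟩), rfl⟩
  obtain ⟨l₁, l₃, h⟩ := h
  exact le_csSup hfin.bddAbove ⟨l₁, m, l₃, h.symm, rfl⟩

theorem gbar_le {l : List ℝ} {c : ℝ} (h : ∀ m, m <:+: l → gfun m.prod ≤ c) : gbar l ≤ c := by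
  refine csSup_le ⟨_, [], [], l, rfl, rfl⟩ ?_
  rintro x ⟨l₁, l₂, l₃, hl, rfl⟩
  exact h l₂ ⟨l₁, l₃, hl.symm⟩

theorem dagger_isInfix {l m : List ℝ} (h : m <:+: l) : dagger m <:+: dagger l := by
  obtain ⟨s, t, rfl⟩ := h
  exact ⟨dagger t, dagger s, by simp [dagger_append]⟩

theorem dagger_isPrefix {l m : List ℝ} (h : m <:+ l) : dagger m <+: dagger l := by
  obtain ⟨s, rfl⟩ := h
  exact ⟨dagger s, by simp [dagger_append]⟩

/-- The quotient of the products of two nested prefixes is the product of a contiguous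
subsequence. -/
theorem gfun_inv_prod_mul_prod_le_gbar {l p q : List ℝ} (hl : ∀ x ∈ l, x ≠ 0)
    (hq : q <+: l) (hpq : p <+: q) : gfun (p.prod⁻¹ * q.prod) ≤ gbar l := by
  obtain ⟨r, rfl⟩ := hpq
  obtain ⟨t, rfl⟩ := hq
  have hp : p.prod ≠ 0 := List.prod_ne_zero fun h => hl 0 (by simp [h]) rfl
  rw [List.prod_append, inv_mul_cancel_left₀ hp]
  exact gfun_prod_le_gbar ⟨p, t, rfl⟩

/-- Eq. (C.96): the squeezing parameter of a circuit of the form `U†U` is no larger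
than that of `U` itself: `ḡ(l† ⧺ l) ≤ ḡ(l)`. -/
theorem gbar_dagger_append_le (l : List ℝ) (hl : ∀ x ∈ l, 0 < x) :
    gbar (dagger l ++ l) ≤ gbar l := by
  have hne : ∀ x ∈ l, x ≠ 0 := fun x hx => (hl x hx).ne'
  refine gbar_le fun m hm => ?_
  rcases List.infix_append_iff.1 hm with h | h | ⟨s, q, rfl, hs, hq⟩
  · rw [← gfun_inv, ← prod_dagger]
    exact gfun_prod_le_gbar (dagger_dagger l ▸ dagger_isInfix h)
  · exact gfun_prod_le_gbar h
  · have hp : dagger s <+: l := dagger_dagger l ▸ dagger_isPrefix hs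
    rw [List.prod_append, ← dagger_dagger s, prod_dagger]
    rcases List.prefix_or_prefix_of_prefix hp hq with h | h
    · exact gfun_inv_prod_mul_prod_le_gbar hne hq h
    · rw [← gfun_inv, mul_inv, inv_inv, mul_comm]
      exact gfun_inv_prod_mul_prod_le_gbar hne hp h
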